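/- arXiv:2005.11370 — 2 statements merged into one kernel-verified Lean document; each statement's English description precedes it below -/
import Mathlib

section
/- For differentiable vector fields $f,g$ write $(L_gf)(x)=Df(x)\,g(x)$. Let $D\subseteq\mathbb R^n$ be a domain and let $h_1,\dots,h_l:D\to\mathbb R^n$ be Lipschitz continuous on $D$, with $h_i\in C^2(D\setminus\Xi;\mathbb R^n)$, where $\Xi=\{\xi\in D: h_i(\xi)=0\text{ for all }1\le i\le l\}$. The Lie derivatives $L_{h_j}h_i$ and $L_{h_k}L_{h_j}h_i$ are then defined on the open set $(D\setminus\Xi)\cup\operatorname{int}\Xi$ (and are zero on $\operatorname{int}\Xi$, where all $h_i$ vanish identically). Assume that for all $i,j,k\in\{1,\dots,l\}$ they admit continuous extensions from this set to all of $D$, denoted by the same symbols. Let $w_i\in C([0,\tau];\mathbb R)$, $1\le i\le l$, and let $\xi:[0,\tau]\to D$ be a solution of $\dot\xi=\sum_{i=1}^l h_i(\xi)w_i(t)$ with $\xi(0)=\xi^0\in D$. Then for all $t\in[0,\tau]$, $$\xi(t)=\xi^0+\sum_{i_1=1}^l h_{i_1}(\xi^0)\int_0^t w_{i_1}(v)\,dv+\sum_{i_1,i_2=1}^l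 (L_{h_{i_2}}h_{i_1})(\xi^0)\int_0^t\int_0^v w_{i_1}(v)w_{i_2}(s)\,ds\,dv+R(t),$$ where $$R(t)=\sum_{i_1,i_2,i_3=1}^l\int_0^t\int_0^v\int_0^s (L_{h_{i_3}}L_{h_{i_2}}h_{i_1})(\xi(p))\,w_{i_1}(v)w_{i_2}(s)w_{i_3}(p)\,dp\,ds\,dv.$$ -/
noncomputable section

/-- The Lie derivative `(L_g f)(x) = Df(x) · g(x)` of the vector field `f` along `g`. -/
def lieDeriv {n : ℕ} (g f : EuclideanSpace ℝ (Fin n) → EuclideanSpace ℝ (Fin n)) :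
    EuclideanSpace ℝ (Fin n) → EuclideanSpace ℝ (Fin n) :=
  fun x => fderiv ℝ f x (g x)

/-- The set `Ξ` of common zeros in `D` of the vector fields `h i`. -/
def commonZeros {n l : ℕ} (D : Set (EuclideanSpace ℝ (Fin n)))
    (h : Fin l → EuclideanSpace ℝ (Fin n) → EuclideanSpace ℝ (Fin n)) :
    Set (EuclideanSpace ℝ (Fin n)) :=
  {x ∈ D | ∀ i, h i x = 0}

/-- `F` is a continuous extension to all of `D` of the (first or iterated) Lie derivative `G`
of the fields `h i`. The fields are differentiable on `D ∖ Ξ`, and also on the interior of `Ξ`,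
where they vanish identically; there `G` is a genuine derivative and `F` has to agree with it.
At the other points of `D` (those of `Ξ` that are limits of points of `D ∖ Ξ`) the fields need
not be differentiable, and the value of `F` is determined by continuity alone. -/
def IsContinuousLieExtension {n l : ℕ} (D : Set (EuclideanSpace ℝ (Fin n)))
    (h : Fin l → EuclideanSpace ℝ (Fin n) → EuclideanSpace ℝ (Fin n))
    (G F : EuclideanSpace ℝ (Fin n) → EuclideanSpace ℝ (Fin n)) : Prop :=
  ContinuousOn F D ∧
    Set.EqOn F G ((D \ commonZeros D h) ∪ interior (commonZeros D h))

end

open Set Filter Topology Metric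
open scoped NNReal

section Integrals

variable {E : Type*} [NormedAddCommGroup E] [NormedSpace ℝ E]

theorem continuousOn_primitive_Icc {T : ℝ} (hT : 0 ≤ T) {u : ℝ → E}
    (hu : ContinuousOn u (Icc 0 T)) :
    ContinuousOn (fun v => ∫ s in (0 : ℝ)..v, u s) (Icc 0 T) := by
  have := intervalIntegral.continuousOn_primitive_interval' (a := 0) (μ := MeasureTheory.volume)
    (hu.intervalIntegrable_of_Icc hT) left_mem_uIcc
  rwa [uIcc_of_le hT] at this

theorem eq_add_sum_integral_of_hasDerivWithinAt [CompleteSpace E] {ι : Type*} [Fintype ι] {T : ℝ}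
    {F : ℝ → E} {w : ι → ℝ → ℝ} {G : ι → ℝ → E}
    (hw : ∀ i, ContinuousOn (w i) (Icc 0 T)) (hG : ∀ i, ContinuousOn (G i) (Icc 0 T))
    (hF : ∀ t ∈ Icc 0 T, HasDerivWithinAt F (∑ i, w i t • G i t) (Icc 0 T) t)
    {t : ℝ} (ht : t ∈ Icc 0 T) :
    F t = F 0 + ∑ i, ∫ s in (0 : ℝ)..t, w i s • G i s := by
  have hsub : Icc 0 t ⊆ Icc 0 T := Icc_subset_Icc_right ht.2
  have hint : ∀ i, IntervalIntegrable (fun s => w i s • G i s) MeasureTheory.volume 0 t :=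
    fun i => (((hw i).smul (hG i)).mono hsub).intervalIntegrable_of_Icc ht.1
  have hsum : IntervalIntegrable (fun s => ∑ i, w i s • G i s) MeasureTheory.volume 0 t := by
    simpa only [Finset.sum_fn] using IntervalIntegrable.sum Finset.univ fun i _ => hint i
  rw [← intervalIntegral.integral_finsetSum fun i _ => hint i,
    intervalIntegral.integral_eq_sub_of_hasDerivAt_of_le ht.1
      (fun s hs => ((hF s (hsub hs)).continuousWithinAt).mono hsub)
      (fun s hs => (hF s (hsub (Ioo_subset_Icc_self hs))).hasDerivAt
        (Icc_mem_nhds hs.1 (hs.2.trans_le ht.2))) hsum]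
  abel

theorem integral_smul_add_sum [CompleteSpace E] {ι : Type*} [Fintype ι] {T : ℝ} (hT : 0 ≤ T)
    {u : ℝ → ℝ} {F : ℝ → E} {c : E} {G : ι → ℝ → E}
    (hu : ContinuousOn u (Icc 0 T)) (hG : ∀ i, ContinuousOn (G i) (Icc 0 T))
    (hF : ∀ t ∈ Icc 0 T, F t = c + ∑ i, G i t) :
    ∫ t in (0 : ℝ)..T, u t • F t
      = (∫ t in (0 : ℝ)..T, u t) • c + ∑ i, ∫ t in (0 : ℝ)..T, u t • G i t := by
  have hint : ∀ i, IntervalIntegrable (fun s => u s • G i s) MeasureTheory.volume 0 T :=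
    fun i => (hu.smul (hG i)).intervalIntegrable_of_Icc hT
  have hcongr : ∫ t in (0 : ℝ)..T, u t • F t
      = ∫ t in (0 : ℝ)..T, (u t • c + ∑ i, u t • G i t) := by
    refine intervalIntegral.integral_congr fun t ht => ?_
    rw [uIcc_of_le hT] at ht
    simp only [hF t ht, smul_add, Finset.smul_sum]
  have hsum : IntervalIntegrable (fun s => ∑ i, u s • G i s) MeasureTheory.volume 0 T := by
    simpa only [Finset.sum_fn] using IntervalIntegrable.sum Finset.univ fun i _ => hint i
  have hconst : IntervalIntegrable (fun s => u s • c) MeasureTheory.volume 0 T :=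
    (hu.smul continuousOn_const).intervalIntegrable_of_Icc hT
  rw [hcongr, intervalIntegral.integral_add hconst hsum,
    intervalIntegral.integral_finsetSum fun i _ => hint i, intervalIntegral.integral_smul_const]

end Integrals

section IntegralCurves

/-- Picard–Lindelöf for an autonomous field, with the curve confined to the ball on which the
field is controlled. -/
theorem exists_integralCurve_mem_closedBall {E : Type*} [NormedAddCommGroup E] [NormedSpace ℝ E]
    [CompleteSpace E] {f : E → E} {x₀ x : E} {a r L K : ℝ≥0} {T : ℝ} (hT : 0 ≤ T)
    (hb : ∀ y ∈ closedBall x₀ a, ‖f y‖ ≤ L) (hl : LipschitzOnWith K f (closedBall x₀ a))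
    (hm : L * T ≤ a - r) (hx : x ∈ closedBall x₀ r) :
    ∃ α : ℝ → E, α 0 = x ∧ ∀ t ∈ Icc 0 T,
      α t ∈ closedBall x₀ a ∧ HasDerivWithinAt α (f (α t)) (Icc 0 T) t := by
  have hf : IsPicardLindelof (fun _ : ℝ => f) (⟨0, le_rfl, hT⟩ : Icc 0 T) x₀ a r L K :=
    .of_time_independent hb hl (by simpa [hT] using hm)
  obtain ⟨α, hα⟩ := ODE.FunSpace.exists_isFixedPt_next hf hx
  have hmem : ∀ t, α.compProj t ∈ closedBall x₀ a :=
    fun t => α.compProj_mem_closedBall hf.mul_max_le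
  refine ⟨α.compProj, ?_, fun t ht => ⟨hmem t, ?_⟩⟩
  · have := ODE.FunSpace.compProj_val (α := α) (t := (⟨0, le_rfl, hT⟩ : Icc 0 T))
    rw [this, ← hα, ODE.FunSpace.next_apply₀]
  · refine (ODE.hasDerivWithinAt_picard_Icc (⟨le_rfl, hT⟩ : (0 : ℝ) ∈ Icc 0 T)
      hf.continuousOn_uncurry α.continuous_compProj.continuousOn (fun t' _ => hmem t')
      x ht).congr_of_mem (fun t' ht' => ?_) ht
    nth_rw 1 [← hα]
    rw [ODE.FunSpace.compProj_of_mem ht', ODE.FunSpace.next_apply]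

end IntegralCurves

section LieExtensions

variable {n l : ℕ} {D : Set (EuclideanSpace ℝ (Fin n))}
  {h : Fin l → EuclideanSpace ℝ (Fin n) → EuclideanSpace ℝ (Fin n)}

theorem isOpen_diff_commonZeros (hD : IsOpen D) (hc : ∀ i, ContinuousOn (h i) D) :
    IsOpen (D \ commonZeros D h) := by
  have heq : D \ commonZeros D h = ⋃ i, D ∩ h i ⁻¹' {0}ᶜ := by
    ext x
    simp only [commonZeros, Set.mem_sdiff, mem_ofPred_eq, mem_iUnion, mem_inter_iff, mem_preimage,
      mem_compl_iff, mem_singleton_iff]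
    constructor
    · rintro ⟨hx, hne⟩
      by_contra! hall
      exact hne ⟨hx, fun i => hall i hx⟩
    · rintro ⟨i, hx, hi⟩
      exact ⟨hx, fun hz => hi (hz.2 i)⟩
  rw [heq]
  exact isOpen_iUnion fun i => (hc i).isOpen_inter_preimage hD isOpen_compl_singleton

theorem nhdsWithin_diff_commonZeros_neBot (hD : IsOpen D) {z : EuclideanSpace ℝ (Fin n)}
    (hz : z ∈ D) (hz' : z ∉ interior (commonZeros D h)) :
    (𝓝[D \ commonZeros D h] z).NeBot := by
  rw [← mem_closure_iff_nhdsWithin_neBot, mem_closure_iff_nhds]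
  intro U hU
  by_contra hempty
  rw [not_nonempty_iff_eq_empty] at hempty
  refine hz' (mem_interior_iff_mem_nhds.2 (mem_of_superset (inter_mem hU (hD.mem_nhds hz)) ?_))
  rintro x ⟨hxU, hxD⟩
  by_contra hx
  exact hempty.subset ⟨hxU, hxD, hx⟩

/-- An admissible trajectory that meets a common zero of the fields is constant. -/
theorem eqOn_const_of_mem_commonZeros (hLip : ∀ i, ∃ K : ℝ≥0, LipschitzOnWith K (h i) D)
    {τ : ℝ} {w : Fin l → ℝ → ℝ} (hw : ∀ i, ContinuousOn (w i) (Icc 0 τ))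
    {ξ : ℝ → EuclideanSpace ℝ (Fin n)} (hξD : ∀ t ∈ Icc 0 τ, ξ t ∈ D)
    (hξ : ∀ t ∈ Icc 0 τ, HasDerivWithinAt ξ (∑ i, w i t • h i (ξ t)) (Icc 0 τ) t)
    {t₀ : ℝ} (ht₀ : t₀ ∈ Icc 0 τ) (hz : ξ t₀ ∈ commonZeros D h) :
    EqOn ξ (fun _ => ξ t₀) (Icc 0 τ) := by
  choose K hK using hLip
  have hbd : ∀ i, ∃ C : ℝ, ∀ t ∈ Icc 0 τ, ‖w i t‖ ≤ C := fun i =>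
    isCompact_Icc.exists_bound_of_continuousOn (hw i)
  choose C hC using hbd
  set M : ℝ≥0 := ∑ i, Real.toNNReal (C i) * K i with hM
  have hv : ∀ t ∈ Icc 0 τ, LipschitzOnWith M (fun x => ∑ i, w i t • h i x) D := by
    intro t ht
    refine LipschitzOnWith.of_dist_le_mul fun x hx y hy => ?_
    rw [dist_eq_norm, dist_eq_norm, ← Finset.sum_sub_distrib, hM]
    push_cast
    rw [Finset.sum_mul]
    refine norm_sum_le_of_le _ fun i _ => ?_
    rw [← smul_sub, norm_smul, mul_assoc]
    exact mul_le_mul ((hC i t ht).trans (Real.le_coe_toNNReal _))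
      ((hK i).norm_sub_le hx hy) (norm_nonneg _) (NNReal.coe_nonneg _)
  have hcont : ContinuousOn ξ (Icc 0 τ) := fun t ht => (hξ t ht).continuousWithinAt
  have hzero : ∀ t, ∑ i, w i t • h i (ξ t₀) = 0 := fun t => by simp [hz.2]
  have hleft : Icc 0 t₀ ⊆ Icc 0 τ := Icc_subset_Icc_right ht₀.2
  have hright : Icc t₀ τ ⊆ Icc 0 τ := Icc_subset_Icc_left ht₀.1
  rw [← Icc_union_Icc_eq_Icc ht₀.1 ht₀.2]
  refine EqOn.union ?_ ?_
  · refine ODE_solution_unique_of_mem_Icc_left (v := fun t x => ∑ i, w i t • h i x)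
      (s := fun _ => D) (K := M) (fun t ht => hv t (hleft (Ioc_subset_Icc_self ht)))
      (hcont.mono hleft) (fun t ht => ?_) (fun t ht => hξD t (hleft (Ioc_subset_Icc_self ht)))
      continuousOn_const (fun t _ => ?_) (fun _ _ => hz.1) rfl
    · exact ((hξ t (hleft (Ioc_subset_Icc_self ht))).mono
        (Icc_subset_Icc_right (ht.2.trans ht₀.2))).mono_of_mem_nhdsWithin
        (Icc_mem_nhdsLE ht.1)
    · simpa only [hzero] using hasDerivWithinAt_const t (Iic t) (ξ t₀)
  · refine ODE_solution_unique_of_mem_Icc_right (v := fun t x => ∑ i, w i t • h i x)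
      (s := fun _ => D) (K := M) (fun t ht => hv t (hright (Ico_subset_Icc_self ht)))
      (hcont.mono hright) (fun t ht => ?_) (fun t ht => hξD t (hright (Ico_subset_Icc_self ht)))
      continuousOn_const (fun t _ => ?_) (fun _ _ => hz.1) rfl
    · exact ((hξ t (hright (Ico_subset_Icc_self ht))).mono
        (Icc_subset_Icc_left (ht₀.1.trans ht.1))).mono_of_mem_nhdsWithin
        (Icc_mem_nhdsGE ht.2)
    · simpa only [hzero] using hasDerivWithinAt_const t (Ici t) (ξ t₀)

theorem norm_lieDeriv_le_of_mem_commonZeros (hD : IsOpen D) {i j : Fin l} {Ki Kj : ℝ≥0}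
    (hKi : LipschitzOnWith Ki (h i) D) (hKj : LipschitzOnWith Kj (h j) D)
    {x z : EuclideanSpace ℝ (Fin n)} (hx : x ∈ D) (hz : z ∈ commonZeros D h) :
    ‖lieDeriv (h j) (h i) x‖ ≤ Ki * (Kj * ‖x - z‖) := by
  have hj : ‖h j x‖ ≤ Kj * ‖x - z‖ := by simpa [hz.2 j] using hKj.norm_sub_le hx hz.1
  exact ((fderiv ℝ (h i) x).le_opNorm _).trans
    (mul_le_mul (norm_fderiv_le_of_lipschitzOn ℝ (hD.mem_nhds hx) hKi) hj (norm_nonneg _)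
      (NNReal.coe_nonneg _))

/-- The continuous extension of `L_{h_j} h_i` vanishes at the common zeros. -/
theorem lieExtension_eq_zero (hD : IsOpen D) (hLip : ∀ i, ∃ K : ℝ≥0, LipschitzOnWith K (h i) D)
    {i j : Fin l} {F : EuclideanSpace ℝ (Fin n) → EuclideanSpace ℝ (Fin n)}
    (hF : IsContinuousLieExtension D h (lieDeriv (h j) (h i)) F)
    {z : EuclideanSpace ℝ (Fin n)} (hz : z ∈ commonZeros D h) : F z = 0 := by
  by_cases hint : z ∈ interior (commonZeros D h)
  · rw [hF.2 (Or.inr hint), lieDeriv, hz.2 j, map_zero]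
  obtain ⟨Ki, hKi⟩ := hLip i
  obtain ⟨Kj, hKj⟩ := hLip j
  have := nhdsWithin_diff_commonZeros_neBot hD hz.1 hint
  refine tendsto_nhds_unique ((hF.1 z hz.1).mono sdiff_subset :
    Tendsto F (𝓝[D \ commonZeros D h] z) (𝓝 (F z))) ?_
  have hlim : Tendsto (fun x => (Ki : ℝ) * (Kj * ‖x - z‖)) (𝓝[D \ commonZeros D h] z) (𝓝 0) := by
    have : Continuous fun x : EuclideanSpace ℝ (Fin n) => (Ki : ℝ) * (Kj * ‖x - z‖) := by fun_prop
    simpa using (this.tendsto z).mono_left nhdsWithin_le_nhds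
  refine squeeze_zero_norm' ?_ hlim
  filter_upwards [self_mem_nhdsWithin] with x hx
  rw [hF.2 (Or.inl hx)]
  exact norm_lieDeriv_le_of_mem_commonZeros hD hKi hKj hx.1 hz

theorem hasFDerivAt_lieExtension (hD : IsOpen D) (hc : ∀ i, ContinuousOn (h i) D)
    (hC2 : ∀ i, ContDiffOn ℝ 2 (h i) (D \ commonZeros D h))
    {i j : Fin l} {F : EuclideanSpace ℝ (Fin n) → EuclideanSpace ℝ (Fin n)}
    (hF : IsContinuousLieExtension D h (lieDeriv (h j) (h i)) F)
    {x : EuclideanSpace ℝ (Fin n)} (hx : x ∈ D \ commonZeros D h) :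
    HasFDerivAt F (fderiv ℝ (lieDeriv (h j) (h i)) x) x := by
  have hU := (isOpen_diff_commonZeros hD hc).mem_nhds hx
  have hi : DifferentiableAt ℝ (fderiv ℝ (h i)) x :=
    (((hC2 i).contDiffAt hU).fderiv_right (m := 1) (by norm_num)).differentiableAt (by norm_num)
  have hj : DifferentiableAt ℝ (h j) x := ((hC2 j).contDiffAt hU).differentiableAt (by norm_num)
  have hdiff : DifferentiableAt ℝ (lieDeriv (h j) (h i)) x := hi.clm_apply hj
  refine hdiff.hasFDerivAt.congr_of_eventuallyEq ?_
  filter_upwards [hU] with y hy using hF.2 (Or.inl hy)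

theorem hasDerivWithinAt_comp_trajectory {w : Fin l → ℝ → ℝ}
    {ξ : ℝ → EuclideanSpace ℝ (Fin n)} {s : Set ℝ} {t : ℝ}
    (hξ : HasDerivWithinAt ξ (∑ k, w k t • h k (ξ t)) s t)
    {F : EuclideanSpace ℝ (Fin n) → EuclideanSpace ℝ (Fin n)}
    {F' : EuclideanSpace ℝ (Fin n) →L[ℝ] EuclideanSpace ℝ (Fin n)} (hF : HasFDerivAt F F' (ξ t)) :
    HasDerivWithinAt (fun t => F (ξ t)) (∑ k, w k t • F' (h k (ξ t))) s t := by
  simpa only [map_sum, map_smul] using! hF.comp_hasDerivWithinAt t hξ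

/-- The continuous extension of `L_{h_k} L_{h_j} h_i` vanishes at the common zeros. Otherwise the
extension of `L_{h_j} h_i` would grow at a definite rate along the flow of `h_k` started near
such a point, for a time that does not depend on how near. -/
theorem iteratedLieExtension_eq_zero (hD : IsOpen D)
    (hLip : ∀ i, ∃ K : ℝ≥0, LipschitzOnWith K (h i) D)
    (hC2 : ∀ i, ContDiffOn ℝ 2 (h i) (D \ commonZeros D h))
    {i j k : Fin l} {F G : EuclideanSpace ℝ (Fin n) → EuclideanSpace ℝ (Fin n)}
    (hF : IsContinuousLieExtension D h (lieDeriv (h j) (h i)) F)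
    (hG : IsContinuousLieExtension D h (lieDeriv (h k) (lieDeriv (h j) (h i))) G)
    {z : EuclideanSpace ℝ (Fin n)} (hz : z ∈ commonZeros D h) : G z = 0 := by
  by_cases hint : z ∈ interior (commonZeros D h)
  · rw [hG.2 (Or.inr hint), lieDeriv, hz.2 k, map_zero]
  have hc : ∀ i, ContinuousOn (h i) D := fun i => (hLip i).choose_spec.continuousOn
  obtain ⟨Ki, hKi⟩ := hLip i
  obtain ⟨Kj, hKj⟩ := hLip j
  obtain ⟨K, hK⟩ := hLip k
  set T : ℝ := 1 / (2 * (K + 1)) with hTdef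
  have hT : 0 < T := by positivity
  have hKT : K * T ≤ 1 / 2 := by
    rw [hTdef, mul_one_div, div_le_div_iff₀ (by positivity) (by norm_num)]
    linarith [K.coe_nonneg]
  suffices hsmall : ∀ ε > 0, ‖G z‖ ≤ 2 * ε by
    refine norm_le_zero_iff.1 (le_of_forall_pos_le_add fun ε hε => ?_)
    linarith [hsmall (ε / 2) (by positivity)]
  intro ε hε
  have hnear : ∀ᶠ x in 𝓝 z, x ∈ D ∧ ‖G x - G z‖ ≤ ε := by
    refine (hD.eventually_mem hz.1).and ?_
    have hGz : ContinuousAt G z := hG.1.continuousAt (hD.mem_nhds hz.1)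
    filter_upwards [hGz (closedBall_mem_nhds (G z) hε)] with x hx
    simpa [dist_eq_norm] using hx
  obtain ⟨δ, hδ, hball⟩ := Metric.nhds_basis_closedBall.eventually_iff.1 hnear
  obtain ⟨ρ, hρ, hρδ, hρε⟩ : ∃ ρ : ℝ≥0, 0 < ρ ∧ (ρ : ℝ) ≤ δ ∧ 2 * (Ki * (Kj * ρ)) ≤ ε * T := by
    have hpos : 0 < min δ (ε * T / (2 * (Ki * Kj + 1))) := by positivity
    refine ⟨⟨_, hpos.le⟩, hpos, min_le_left _ _, ?_⟩
    have hle : min δ (ε * T / (2 * (Ki * Kj + 1))) ≤ ε * T / (2 * (Ki * Kj + 1)) :=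
      min_le_right _ _
    rw [le_div_iff₀ (by positivity)] at hle
    change 2 * (Ki * (Kj * min δ (ε * T / (2 * (Ki * Kj + 1))))) ≤ ε * T
    nlinarith
  have hsub : ∀ x ∈ closedBall z ρ, x ∈ D ∧ ‖G x - G z‖ ≤ ε :=
    fun x hx => hball (closedBall_subset_closedBall hρδ hx)
  have hne := nhdsWithin_diff_commonZeros_neBot hD hz.1 hint
  obtain ⟨x, hxz, hxU⟩ : (closedBall z (ρ / 2 : ℝ≥0) ∩ (D \ commonZeros D h)).Nonempty :=
    mem_closure_iff_nhds.1 (mem_closure_iff_nhdsWithin_neBot.2 hne) _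
      (closedBall_mem_nhds z (by positivity))
  obtain ⟨α, hα0, hα⟩ := exists_integralCurve_mem_closedBall (f := h k) (x₀ := z) (x := x)
    (a := ρ) (r := ρ / 2) (L := K * ρ) (K := K) hT.le
    (fun y hy => by
      have hy' : ‖h k y‖ ≤ K * ‖y - z‖ := by
        simpa [hz.2 k] using hK.norm_sub_le (hsub y hy).1 hz.1
      push_cast
      exact hy'.trans (mul_le_mul_of_nonneg_left (by simpa [dist_eq_norm] using hy) K.coe_nonneg))
    (hK.mono fun y hy => (hsub y hy).1)
    (by
      push_cast
      nlinarith [ρ.coe_nonneg])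
    hxz
  have hαξ : ∀ t ∈ Icc 0 T, HasDerivWithinAt α
      (∑ m, (fun _ => if m = k then (1 : ℝ) else 0 : ℝ → ℝ) t • h m (α t)) (Icc 0 T) t := by
    intro t ht
    simpa using (hα t ht).2
  have hαU : ∀ t ∈ Icc 0 T, α t ∈ D \ commonZeros D h := by
    intro t ht
    refine ⟨(hsub _ (hα t ht).1).1, fun hmem => hxU.2 ?_⟩
    have hconst := eqOn_const_of_mem_commonZeros hLip
      (w := fun m _ => if m = k then (1 : ℝ) else 0) (fun _ => continuousOn_const)
      (fun t ht => (hsub _ (hα t ht).1).1) hαξ ht hmem (left_mem_Icc.2 hT.le)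
    rw [← hα0, hconst]
    exact hmem
  have hderiv : ∀ t ∈ Icc 0 T, HasDerivWithinAt (fun t => F (α t) - t • G z)
      (G (α t) - G z) (Icc 0 T) t := by
    intro t ht
    have h1 := (hasFDerivAt_lieExtension hD hc hC2 hF (hαU t ht)).comp_hasDerivWithinAt t
      (hα t ht).2
    have h2 := ((hasDerivWithinAt_id t (Icc 0 T)).smul_const (G z))
    rw [hG.2 (Or.inl (hαU t ht))]
    simpa using! h1.sub h2
  have hmv := norm_image_sub_le_of_norm_deriv_le_segment' hderiv
    (fun t ht => (hsub _ (hα t (Ico_subset_Icc_self ht)).1).2) T (right_mem_Icc.2 hT.le)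
  have hbound : ∀ t ∈ Icc 0 T, ‖F (α t)‖ ≤ Ki * (Kj * ρ) := by
    intro t ht
    rw [hF.2 (Or.inl (hαU t ht))]
    refine (norm_lieDeriv_le_of_mem_commonZeros hD hKi hKj (hαU t ht).1 hz).trans ?_
    have : ‖α t - z‖ ≤ ρ := by simpa [dist_eq_norm] using (hα t ht).1
    gcongr
  have hb0 := hbound 0 (left_mem_Icc.2 hT.le)
  have hbT := hbound T (right_mem_Icc.2 hT.le)
  have htri : ‖T • G z‖ ≤ ‖F (α T)‖ + ‖F (α 0)‖
      + ‖F (α T) - T • G z - (F (α 0) - (0 : ℝ) • G z)‖ := by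
    have heq : T • G z = F (α T) - F (α 0)
        - (F (α T) - T • G z - (F (α 0) - (0 : ℝ) • G z)) := by
      rw [zero_smul]; abel
    calc ‖T • G z‖ = _ := congrArg norm heq
      _ ≤ _ := (norm_sub_le _ _).trans (add_le_add_left (norm_sub_le _ _) _)
  rw [norm_smul, Real.norm_of_nonneg hT.le] at htri
  refine le_of_mul_le_mul_left ?_ hT
  linarith

end LieExtensions

theorem chen_fliess_expansion {n l : ℕ}
    (D : Set (EuclideanSpace ℝ (Fin n))) (hD : IsOpen D)
    (h : Fin l → EuclideanSpace ℝ (Fin n) → EuclideanSpace ℝ (Fin n))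
    (hLip : ∀ i, ∃ K : NNReal, LipschitzOnWith K (h i) D)
    (hC2 : ∀ i, ContDiffOn ℝ 2 (h i) (D \ commonZeros D h))
    -- `L₂ j i` extends `L_{h_j} h_i`, and `L₃ k j i` extends `L_{h_k} L_{h_j} h_i`
    (L₂ : Fin l → Fin l → EuclideanSpace ℝ (Fin n) → EuclideanSpace ℝ (Fin n))
    (L₃ : Fin l → Fin l → Fin l → EuclideanSpace ℝ (Fin n) → EuclideanSpace ℝ (Fin n))
    (hL₂ : ∀ j i, IsContinuousLieExtension D h (lieDeriv (h j) (h i)) (L₂ j i))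
    (hL₃ : ∀ k j i, IsContinuousLieExtension D h
      (lieDeriv (h k) (lieDeriv (h j) (h i))) (L₃ k j i))
    (τ : ℝ) (hτ : 0 ≤ τ)
    (w : Fin l → ℝ → ℝ) (hw : ∀ i, ContinuousOn (w i) (Set.Icc 0 τ))
    (ξ : ℝ → EuclideanSpace ℝ (Fin n)) (ξ₀ : EuclideanSpace ℝ (Fin n))
    (hξD : ∀ t ∈ Set.Icc 0 τ, ξ t ∈ D)
    (hξ : ∀ t ∈ Set.Icc 0 τ,
      HasDerivWithinAt ξ (∑ i : Fin l, w i t • h i (ξ t)) (Set.Icc 0 τ) t)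
    (hξ₀ : ξ 0 = ξ₀) :
    ∀ t ∈ Set.Icc 0 τ,
      ξ t = ξ₀
        + (∑ i₁ : Fin l, (∫ v in (0 : ℝ)..t, w i₁ v) • h i₁ ξ₀)
        + (∑ i₁ : Fin l, ∑ i₂ : Fin l,
            (∫ v in (0 : ℝ)..t, ∫ s in (0 : ℝ)..v, w i₁ v * w i₂ s) • L₂ i₂ i₁ ξ₀)
        + (∑ i₁ : Fin l, ∑ i₂ : Fin l, ∑ i₃ : Fin l,
            ∫ v in (0 : ℝ)..t, ∫ s in (0 : ℝ)..v, ∫ p in (0 : ℝ)..s,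
              (w i₁ v * w i₂ s * w i₃ p) • L₃ i₃ i₂ i₁ (ξ p)) := by
  have hc : ∀ i, ContinuousOn (h i) D := fun i => (hLip i).choose_spec.continuousOn
  have hξc : ContinuousOn ξ (Icc 0 τ) := fun t ht => (hξ t ht).continuousWithinAt
  have hhξ : ∀ i, ContinuousOn (fun t => h i (ξ t)) (Icc 0 τ) :=
    fun i => (hc i).comp hξc hξD
  have hL₂ξ : ∀ j i, ContinuousOn (fun t => L₂ j i (ξ t)) (Icc 0 τ) :=
    fun j i => (hL₂ j i).1.comp hξc hξD
  have hL₃ξ : ∀ k j i, ContinuousOn (fun t => L₃ k j i (ξ t)) (Icc 0 τ) :=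
    fun k j i => (hL₃ k j i).1.comp hξc hξD
  have hderiv : (∀ i, ∀ t ∈ Icc 0 τ, HasDerivWithinAt (fun t => h i (ξ t))
        (∑ j, w j t • L₂ j i (ξ t)) (Icc 0 τ) t) ∧
      ∀ i j, ∀ t ∈ Icc 0 τ, HasDerivWithinAt (fun t => L₂ j i (ξ t))
        (∑ k, w k t • L₃ k j i (ξ t)) (Icc 0 τ) t := by
    by_cases hmeet : ∃ t₀ ∈ Icc 0 τ, ξ t₀ ∈ commonZeros D h
    · obtain ⟨t₀, ht₀, hz⟩ := hmeet
      have hconst := eqOn_const_of_mem_commonZeros hLip hw hξD hξ ht₀ hz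
      have h₂ : ∀ j i, L₂ j i (ξ t₀) = 0 := fun j i => lieExtension_eq_zero hD hLip (hL₂ j i) hz
      have h₃ : ∀ k j i, L₃ k j i (ξ t₀) = 0 := fun k j i =>
        iteratedLieExtension_eq_zero hD hLip hC2 (hL₂ j i) (hL₃ k j i) hz
      have hcomp : ∀ F : EuclideanSpace ℝ (Fin n) → EuclideanSpace ℝ (Fin n), ∀ t ∈ Icc 0 τ,
          HasDerivWithinAt (fun t => F (ξ t)) 0 (Icc 0 τ) t := fun F t ht =>
        (hasDerivWithinAt_const t (Icc 0 τ) (F (ξ t₀))).congr_of_mem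
          (fun s hs => congrArg F (hconst hs)) ht
      refine ⟨fun i t ht => ?_, fun i j t ht => ?_⟩
      · simpa [hconst ht, h₂] using hcomp (h i) t ht
      · simpa [hconst ht, h₃] using hcomp (L₂ j i) t ht
    · have hU : ∀ t ∈ Icc 0 τ, ξ t ∈ D \ commonZeros D h :=
        fun t ht => ⟨hξD t ht, fun hz => hmeet ⟨t, ht, hz⟩⟩
      refine ⟨fun i t ht => ?_, fun i j t ht => ?_⟩
      · have hd : DifferentiableAt ℝ (h i) (ξ t) := ((hC2 i).contDiffAt
          ((isOpen_diff_commonZeros hD hc).mem_nhds (hU t ht))).differentiableAt (by norm_num)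
        simp only [fun j => (hL₂ j i).2 (Or.inl (hU t ht))]
        exact hasDerivWithinAt_comp_trajectory (hξ t ht) hd.hasFDerivAt
      · simp only [fun k => (hL₃ k j i).2 (Or.inl (hU t ht))]
        exact hasDerivWithinAt_comp_trajectory (hξ t ht)
          (hasFDerivAt_lieExtension hD hc hC2 (hL₂ j i) (hU t ht))
  have expand₁ : ∀ i, ∀ t ∈ Icc 0 τ, h i (ξ t)
      = h i ξ₀ + ∑ j, ∫ s in (0 : ℝ)..t, w j s • L₂ j i (ξ s) := fun i t ht => by
    simpa only [hξ₀] using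
      eq_add_sum_integral_of_hasDerivWithinAt hw (fun j => hL₂ξ j i) (hderiv.1 i) ht
  have expand₂ : ∀ i j, ∀ t ∈ Icc 0 τ, L₂ j i (ξ t)
      = L₂ j i ξ₀ + ∑ k, ∫ s in (0 : ℝ)..t, w k s • L₃ k j i (ξ s) := fun i j t ht => by
    simpa only [hξ₀] using
      eq_add_sum_integral_of_hasDerivWithinAt hw (fun k => hL₃ξ k j i) (hderiv.2 i j) ht
  have hprim : ∀ {T : ℝ}, T ∈ Icc 0 τ → ∀ {u : ℝ → EuclideanSpace ℝ (Fin n)},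
      ContinuousOn u (Icc 0 τ) → ContinuousOn (fun v => ∫ s in (0 : ℝ)..v, u s) (Icc 0 T) :=
    fun hT _ hu => continuousOn_primitive_Icc hT.1 (hu.mono (Icc_subset_Icc_right hT.2))
  have hprimτ : ∀ {u : ℝ → EuclideanSpace ℝ (Fin n)}, ContinuousOn u (Icc 0 τ) →
      ContinuousOn (fun v => ∫ s in (0 : ℝ)..v, u s) (Icc 0 τ) :=
    fun hu => continuousOn_primitive_Icc hτ hu
  intro t ht
  have hsub : Icc 0 t ⊆ Icc 0 τ := Icc_subset_Icc_right ht.2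
  have inner : ∀ i j, ∀ v ∈ Icc 0 t, ∫ s in (0 : ℝ)..v, w j s • L₂ j i (ξ s)
      = (∫ s in (0 : ℝ)..v, w j s) • L₂ j i ξ₀
        + ∑ k, ∫ s in (0 : ℝ)..v, w j s • ∫ p in (0 : ℝ)..s, w k p • L₃ k j i (ξ p) := by
    intro i j v hv
    have hv' := hsub hv
    exact integral_smul_add_sum hv.1 ((hw j).mono (Icc_subset_Icc_right hv'.2))
      (fun k => hprim hv' ((hw k).smul (hL₃ξ k j i)))
      (fun s hs => expand₂ i j s (Icc_subset_Icc_right hv'.2 hs))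
  have middle : ∀ i j, ∫ v in (0 : ℝ)..t, w i v • ∫ s in (0 : ℝ)..v, w j s • L₂ j i (ξ s)
      = (∫ v in (0 : ℝ)..t, w i v * ∫ s in (0 : ℝ)..v, w j s) • L₂ j i ξ₀
        + ∑ k, ∫ v in (0 : ℝ)..t, w i v • ∫ s in (0 : ℝ)..v,
            w j s • ∫ p in (0 : ℝ)..s, w k p • L₃ k j i (ξ p) := by
    intro i j
    have hwj : ContinuousOn (fun v => (∫ s in (0 : ℝ)..v, w j s) • L₂ j i ξ₀) (Icc 0 t) :=
      ((continuousOn_primitive_Icc hτ (hw j)).mono hsub).smul continuousOn_const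
    have hrest : ∀ k, ContinuousOn (fun v => ∫ s in (0 : ℝ)..v,
        w j s • ∫ p in (0 : ℝ)..s, w k p • L₃ k j i (ξ p)) (Icc 0 t) := fun k =>
      hprim ht ((hw j).smul (hprimτ ((hw k).smul (hL₃ξ k j i))))
    have hsplit := integral_smul_add_sum (ι := Option (Fin l)) ht.1 ((hw i).mono hsub)
      (F := fun v => ∫ s in (0 : ℝ)..v, w j s • L₂ j i (ξ s)) (c := 0)
      (G := fun o => o.elim (fun v => (∫ s in (0 : ℝ)..v, w j s) • L₂ j i ξ₀)
        (fun k v => ∫ s in (0 : ℝ)..v, w j s • ∫ p in (0 : ℝ)..s, w k p • L₃ k j i (ξ p)))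
      (fun o => by cases o with
        | none => exact hwj
        | some k => exact hrest k)
      (fun v hv => by simpa [Fintype.sum_option] using inner i j v hv)
    simpa only [Fintype.sum_option, Option.elim_none, Option.elim_some, smul_zero, zero_add,
      smul_smul, intervalIntegral.integral_smul_const] using hsplit
  have outer : ∀ i, ∫ v in (0 : ℝ)..t, w i v • h i (ξ v)
      = (∫ v in (0 : ℝ)..t, w i v) • h i ξ₀
        + ∑ j, ∫ v in (0 : ℝ)..t, w i v • ∫ s in (0 : ℝ)..v, w j s • L₂ j i (ξ s) := fun i =>
    integral_smul_add_sum ht.1 ((hw i).mono hsub)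
      (fun j => hprim ht ((hw j).smul (hL₂ξ j i))) (fun s hs => expand₁ i s (hsub hs))
  rw [eq_add_sum_integral_of_hasDerivWithinAt hw hhξ hξ ht, hξ₀]
  simp only [outer, middle, Finset.sum_add_distrib, mul_smul, intervalIntegral.integral_smul,
    intervalIntegral.integral_const_mul, add_assoc]
end

section
/- Let $D\subseteq\mathbb R^n$ be convex and let $J\in C^2(D;\mathbb R)$ with gradient $\nabla J$ and Hessian $\partial^2J/\partial x^2$ on $D$. Here, for a set $D$ that need not be open, this means that $\nabla J:D\to\mathbb R^n$ is a derivative of $J$ relative to $D$, i.e. $J(y)=J(x)+\langle\nabla J(x),y-x\rangle+o(\|y-x\|)$ as $y\to x$, $y\in D$, for every $x\in D$, that $\partial^2J/\partial x^2:D\to\mathbb R^{n\times n}$ is in the same sense a derivative of $\nabla J$ relative to $D$, and that $\partial^2J/\partial x^2$ is continuous on $D$; if $D$ is open, these are the usual gradient and Hessian. Let $x^*\in D$, $J^*=J(x^*)$, and suppose that for all $x\in D$ $$\sigma_{21}(J(x)-J^*)\le\|\nabla J(x)\|^2\le\sigma_{22}(J(x)-J^*)\quad\text{and}\quad\Big\|\frac{\partial^2J(x)}{\partial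 x^2}\Big\|\le\sigma_3,$$ with $\sigma_{21},\sigma_{22},\sigma_3>0$, where $\|\cdot\|$ is the Euclidean norm for vectors and the induced operator norm for matrices. Let $\mu,\gamma_2,\zeta,\varsigma>0$, let $\xi^0\in D$, let $R\in\mathbb R^n$ with $\|R\|\le\zeta\mu^{1+\varsigma}$, and suppose that $\xi^1=\xi^0-\mu\gamma_2\nabla J(\xi^0)+R$ belongs to $D$. Then $$J(\xi^1)-J^*\le(J(\xi^0)-J^*)\big(1-\mu\gamma_2(\sigma_{21}-\mu\gamma_2\sigma_3\sigma_{22})\big)+\mu^{1+\varsigma}\zeta\Big(\sqrt{\sigma_{22}(J(\xi^0)-J^*)}+\sigma_3\zeta\mu^{1+\varsigma}\Big).$$ -/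
/-- `J` is of class `C²` on the set `D ⊆ ℝⁿ`, with gradient `gradJ` and Hessian `hessJ` there.
All derivatives are taken relative to `D`, so that only the values of `J` on `D` matter and `D` need
not be open. The norm of `hessJ x` is the operator norm for the Euclidean norm on `ℝⁿ`.
If `D` is open, then `gradJ` and `hessJ` agree on `D` with the usual gradient and Hessian of `J`; if
`D` is convex with nonempty interior, they are still uniquely determined on `D`. -/
structure HasC2DerivativesOn {n : ℕ} (J : EuclideanSpace ℝ (Fin n) → ℝ)
    (gradJ : EuclideanSpace ℝ (Fin n) → EuclideanSpace ℝ (Fin n))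
    (hessJ : EuclideanSpace ℝ (Fin n) →
      (EuclideanSpace ℝ (Fin n) →L[ℝ] EuclideanSpace ℝ (Fin n)))
    (D : Set (EuclideanSpace ℝ (Fin n))) : Prop where
  hasGradient : ∀ x ∈ D, HasGradientWithinAt J (gradJ x) D x
  hasHessian : ∀ x ∈ D, HasFDerivWithinAt gradJ (hessJ x) D x
  continuousOn_hessian : ContinuousOn hessJ D

open scoped RealInnerProductSpace in
/-- **Descent lemma.** If `J` has gradient `gradJ` relative to a convex set `D`, and `gradJ` has
derivative bounded by `σ` relative to `D`, then `J` lies below its quadratic upper model on `D`. -/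
theorem Convex.le_add_inner_add_sq_of_norm_hessian_le {E : Type*} [NormedAddCommGroup E]
    [InnerProductSpace ℝ E] [CompleteSpace E] {D : Set E} (hD : Convex ℝ D)
    {J : E → ℝ} {gradJ : E → E} {hessJ : E → E →L[ℝ] E}
    (hgrad : ∀ x ∈ D, HasGradientWithinAt J (gradJ x) D x)
    (hhess : ∀ x ∈ D, HasFDerivWithinAt gradJ (hessJ x) D x)
    {σ : ℝ} (hσ : ∀ x ∈ D, ‖hessJ x‖ ≤ σ) {x y : E} (hx : x ∈ D) (hy : y ∈ D) :
    J y ≤ J x + ⟪gradJ x, y - x⟫ + σ / 2 * ‖y - x‖ ^ 2 := by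
  set d := y - x with hd
  have hmem : ∀ t ∈ Set.Icc (0 : ℝ) 1, x + t • d ∈ D := fun t ht =>
    hD.add_smul_sub_mem hx hy ht
  have hderiv : ∀ t ∈ Set.Icc (0 : ℝ) 1, HasDerivWithinAt (fun s : ℝ => J (x + s • d))
      ⟪gradJ (x + t • d), d⟫ (Set.Icc 0 1) t := fun t ht => by
    have hline : HasDerivWithinAt (fun s : ℝ => x + s • d) d (Set.Icc 0 1) t := by
      simpa using (((hasDerivAt_id t).smul_const d).const_add x).hasDerivWithinAt
    exact ((hgrad _ (hmem t ht)).hasFDerivWithinAt.comp_hasDerivWithinAt t hline hmem).congr_deriv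
      (by simp)
  have hbound : ∀ t ∈ Set.Ico (0 : ℝ) 1,
      ⟪gradJ (x + t • d), d⟫ ≤ ⟪gradJ x, d⟫ + σ * ‖d‖ ^ 2 * t := fun t ht => by
    have hlip : ‖gradJ (x + t • d) - gradJ x‖ ≤ σ * (t * ‖d‖) := by
      simpa [norm_smul, abs_of_nonneg ht.1] using
        hD.norm_image_sub_le_of_norm_hasFDerivWithin_le hhess hσ hx
          (hmem t (Set.Ico_subset_Icc_self ht))
    calc ⟪gradJ (x + t • d), d⟫
        = ⟪gradJ x, d⟫ + ⟪gradJ (x + t • d) - gradJ x, d⟫ := by rw [inner_sub_left]; ring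
      _ ≤ ⟪gradJ x, d⟫ + ‖gradJ (x + t • d) - gradJ x‖ * ‖d‖ := by
        gcongr; exact real_inner_le_norm _ _
      _ ≤ ⟪gradJ x, d⟫ + σ * (t * ‖d‖) * ‖d‖ := by gcongr
      _ = ⟪gradJ x, d⟫ + σ * ‖d‖ ^ 2 * t := by ring
  have hmodel : ∀ t : ℝ, HasDerivAt
      (fun s : ℝ => J x + ⟪gradJ x, d⟫ * s + σ / 2 * ‖d‖ ^ 2 * s ^ 2)
      (⟪gradJ x, d⟫ + σ * ‖d‖ ^ 2 * t) t := fun t => by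
    refine ((((hasDerivAt_id t).const_mul ⟪gradJ x, d⟫).const_add (J x)).add
      ((hasDerivAt_pow 2 t).const_mul (σ / 2 * ‖d‖ ^ 2))).congr_deriv ?_
    push_cast
    ring
  have key := image_le_of_deriv_right_le_deriv_boundary
    (fun t ht => (hderiv t ht).continuousWithinAt)
    (fun t ht => (hderiv t (Set.Ico_subset_Icc_self ht)).mono_of_mem_nhdsWithin
      (Icc_mem_nhdsGE_of_mem ht))
    (by simp) (fun t _ => (hmodel t).continuousAt.continuousWithinAt)
    (fun t _ => (hmodel t).hasDerivWithinAt) hbound (Set.right_mem_Icc.2 zero_le_one)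
  simpa [hd] using key

/-- **One-step decay of the cost along a perturbed gradient step.** -/
theorem cost_decay_step {n : ℕ}
    (D : Set (EuclideanSpace ℝ (Fin n))) (hDconv : Convex ℝ D)
    (J : EuclideanSpace ℝ (Fin n) → ℝ)
    (gradJ : EuclideanSpace ℝ (Fin n) → EuclideanSpace ℝ (Fin n))
    (hessJ : EuclideanSpace ℝ (Fin n) →
      (EuclideanSpace ℝ (Fin n) →L[ℝ] EuclideanSpace ℝ (Fin n)))
    (hJ : HasC2DerivativesOn J gradJ hessJ D)
    (xs : EuclideanSpace ℝ (Fin n)) (hxs : xs ∈ D)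
    (σ21 σ22 σ3 : ℝ) (hσ21 : 0 < σ21) (hσ22 : 0 < σ22) (hσ3 : 0 < σ3)
    (hJ2 : ∀ x ∈ D, σ21 * (J x - J xs) ≤ ‖gradJ x‖ ^ 2 ∧
      ‖gradJ x‖ ^ 2 ≤ σ22 * (J x - J xs))
    (hJ3 : ∀ x ∈ D, ‖hessJ x‖ ≤ σ3)
    (μ γ₂ ζ ς : ℝ) (hμ : 0 < μ) (hγ₂ : 0 < γ₂) (hζ : 0 < ζ) (hς : 0 < ς)
    (ξ0 : EuclideanSpace ℝ (Fin n)) (hξ0 : ξ0 ∈ D)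
    (R : EuclideanSpace ℝ (Fin n)) (hR : ‖R‖ ≤ ζ * μ ^ (1 + ς))
    (ξ1 : EuclideanSpace ℝ (Fin n))
    (hξ1def : ξ1 = ξ0 - (μ * γ₂) • gradJ ξ0 + R)
    (hξ1 : ξ1 ∈ D) :
    J ξ1 - J xs ≤ (J ξ0 - J xs) * (1 - μ * γ₂ * (σ21 - μ * γ₂ * σ3 * σ22)) +
      μ ^ (1 + ς) * ζ * (Real.sqrt (σ22 * (J ξ0 - J xs)) + σ3 * ζ * μ ^ (1 + ς)) := by
  set g := gradJ ξ0
  set a := μ * γ₂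
  set r := μ ^ (1 + ς)
  set e := J ξ0 - J xs with he
  have ha : 0 < a := mul_pos hμ hγ₂
  obtain ⟨hlow, hup⟩ := hJ2 ξ0 hξ0
  have hstep : ξ1 - ξ0 = R - a • g := by rw [hξ1def]; abel
  have hdescent := hDconv.le_add_inner_add_sq_of_norm_hessian_le hJ.hasGradient hJ.hasHessian
    hJ3 hξ0 hξ1
  have hinner : inner ℝ g (ξ1 - ξ0) ≤ ‖g‖ * ‖R‖ - a * ‖g‖ ^ 2 := by
    rw [hstep, inner_sub_right, inner_smul_right, real_inner_self_eq_norm_sq]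
    gcongr
    exact real_inner_le_norm _ _
  have hsq : ‖ξ1 - ξ0‖ ^ 2 ≤ 2 * (‖R‖ ^ 2 + a ^ 2 * ‖g‖ ^ 2) := by
    have hpar := parallelogram_law_with_norm ℝ R (a • g)
    have hnorm : ‖a • g‖ = a * ‖g‖ := by rw [norm_smul, Real.norm_of_nonneg ha.le]
    rw [hstep]
    rw [hnorm] at hpar
    nlinarith [mul_self_nonneg ‖R + a • g‖]
  have hcross : ‖g‖ * ‖R‖ ≤ √(σ22 * e) * (ζ * r) :=
    mul_le_mul (Real.le_sqrt_of_sq_le hup) hR (norm_nonneg _) (Real.sqrt_nonneg _)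
  have hRsq : ‖R‖ ^ 2 ≤ (ζ * r) ^ 2 := by gcongr
  calc J ξ1 - J xs
      ≤ e + inner ℝ g (ξ1 - ξ0) + σ3 / 2 * ‖ξ1 - ξ0‖ ^ 2 := by linarith
    _ ≤ e + (‖g‖ * ‖R‖ - a * ‖g‖ ^ 2) + σ3 / 2 * (2 * (‖R‖ ^ 2 + a ^ 2 * ‖g‖ ^ 2)) := by gcongr
    _ = e - a * ‖g‖ ^ 2 + σ3 * a ^ 2 * ‖g‖ ^ 2 + ‖g‖ * ‖R‖ + σ3 * ‖R‖ ^ 2 := by ring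
    _ ≤ e - a * (σ21 * e) + σ3 * a ^ 2 * (σ22 * e) + √(σ22 * e) * (ζ * r)
        + σ3 * (ζ * r) ^ 2 := by gcongr
    _ = e * (1 - a * (σ21 - a * σ3 * σ22)) + r * ζ * (√(σ22 * e) + σ3 * ζ * r) := by ring
end
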